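/- The sequence of averages (1/N) · Σ_{n=1}^N n^{2πi} does not converge as N → ∞. -/

import Mathlib

open Filter Finset

/-- A purely imaginary power of a positive real close to `1` is close to `1`. -/
theorem norm_ofReal_cpow_mul_I_sub_one_le {t : ℝ} (ht : 1 ≤ t) {a : ℝ} (ha : 0 ≤ a) :
    ‖(t : ℂ) ^ ((a : ℂ) * Complex.I) - 1‖ ≤ a * (t - 1) := by
  have ht0 : 0 < t := by linarith
  have h : (t : ℂ) ^ ((a : ℂ) * Complex.I) =
      Complex.exp (Complex.I * ((a * Real.log t : ℝ) : ℂ)) := by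
    rw [Complex.cpow_def_of_ne_zero (by exact_mod_cast ht0.ne'), ← Complex.ofReal_log ht0.le]
    push_cast
    ring_nf
  rw [h]
  refine (Real.norm_exp_I_mul_ofReal_sub_one_le).trans ?_
  rw [Real.norm_of_nonneg (mul_nonneg ha (Real.log_nonneg ht))]
  exact mul_le_mul_of_nonneg_left (Real.log_le_sub_one_of_pos ht0) ha

/-- Averages over the windows `(20K, 21K]` inherit the limit of the averages over `[1, N]`. -/
theorem tendsto_window_average {a : ℕ → ℂ} {L : ℂ}
    (h : Tendsto (fun N : ℕ => (∑ n ∈ Icc 1 N, a n) / N) atTop (nhds L)) :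
    Tendsto (fun K : ℕ => (∑ n ∈ Ioc (20 * K) (21 * K), a n) / K) atTop (nhds L) := by
  have h1 := h.comp (tendsto_id.const_mul_atTop' (show 0 < 21 by norm_num))
  have h2 := h.comp (tendsto_id.const_mul_atTop' (show 0 < 20 by norm_num))
  have h3 := (h1.const_mul 21).sub (h2.const_mul 20)
  have hL : 21 * L - 20 * L = L := by ring
  rw [hL] at h3
  refine h3.congr' ?_
  filter_upwards [eventually_gt_atTop 0] with K hK
  have hK' : (K : ℂ) ≠ 0 := by exact_mod_cast hK.ne'
  have hs : ∑ n ∈ Icc 1 (20 * K), a n + ∑ n ∈ Ioc (20 * K) (21 * K), a n =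
      ∑ n ∈ Icc 1 (21 * K), a n := by
    have hI (m : ℕ) : Icc 1 m = Ioc 0 m := by
      ext
      simp [Nat.one_le_iff_ne_zero, Nat.pos_iff_ne_zero]
    rw [hI, hI]
    exact sum_Ioc_consecutive a (Nat.zero_le _) (by omega)
  simp only [Function.comp, id]
  rw [← hs]
  push_cast
  field_simp
  ring

/-- Averages of `n ^ (2πi)` over `(20K, 21K]` stay close to `(20K) ^ (2πi)`. -/
theorem norm_window_average_sub_le {K : ℕ} (hK : 0 < K) :
    ‖(∑ n ∈ Ioc (20 * K) (21 * K), (n : ℂ) ^ (2 * (Real.pi : ℂ) * Complex.I)) / K -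
      (20 : ℂ) ^ (2 * (Real.pi : ℂ) * Complex.I) * (K : ℂ) ^ (2 * (Real.pi : ℂ) * Complex.I)‖
      ≤ 1 / 3 := by
  set s : ℂ := 2 * (Real.pi : ℂ) * Complex.I with hs
  have hsa : s = ((2 * Real.pi : ℝ) : ℂ) * Complex.I := by rw [hs]; push_cast; ring
  have hKr : (0 : ℝ) < K := by exact_mod_cast hK
  have hKc : (K : ℂ) ≠ 0 := by exact_mod_cast hK.ne'
  have hmul : (20 : ℂ) ^ s * (K : ℂ) ^ s = ((20 * K : ℝ) : ℂ) ^ s := by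
    have := Complex.mul_cpow_ofReal_nonneg (a := 20) (b := K) (by norm_num) hKr.le s
    push_cast at this ⊢
    exact this.symm
  have hnorm : ‖((20 * K : ℝ) : ℂ) ^ s‖ = 1 := by
    rw [Complex.norm_cpow_eq_rpow_re_of_pos (by positivity)]
    simp [hs]
  have hterm : ∀ n ∈ Ioc (20 * K) (21 * K),
      ‖(n : ℂ) ^ s - ((20 * K : ℝ) : ℂ) ^ s‖ ≤ 1 / 3 := by
    intro n hn
    rw [mem_Ioc] at hn
    have hn1 : (20 * K : ℝ) ≤ n := by exact_mod_cast hn.1.le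
    have hn2 : (n : ℝ) ≤ 21 * K := by exact_mod_cast hn.2
    have ht1 : 1 ≤ (n : ℝ) / (20 * K) := by rw [le_div_iff₀ (by positivity)]; linarith
    have ht2 : (n : ℝ) / (20 * K) ≤ 21 / 20 := by
      rw [div_le_iff₀ (by positivity)]; linarith
    have hsplit : (n : ℂ) ^ s = ((20 * K : ℝ) : ℂ) ^ s * (((n : ℝ) / (20 * K) : ℝ) : ℂ) ^ s := by
      rw [← Complex.mul_cpow_ofReal_nonneg (by positivity) (by positivity), ← Complex.ofReal_mul,
        mul_div_cancel₀ _ (by positivity), Complex.ofReal_natCast]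
    rw [hsplit, ← mul_sub_one, norm_mul, hnorm, one_mul, hsa]
    refine (norm_ofReal_cpow_mul_I_sub_one_le ht1 (by positivity)).trans ?_
    nlinarith [Real.pi_lt_d2, Real.pi_pos]
  have hcard : (Ioc (20 * K) (21 * K)).card = K := by rw [Nat.card_Ioc]; omega
  have hsum : (∑ n ∈ Ioc (20 * K) (21 * K), (n : ℂ) ^ s) / K - ((20 * K : ℝ) : ℂ) ^ s =
      (∑ n ∈ Ioc (20 * K) (21 * K), ((n : ℂ) ^ s - ((20 * K : ℝ) : ℂ) ^ s)) / K := by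
    rw [sum_sub_distrib, sum_const, hcard, nsmul_eq_mul]
    field_simp
  rw [hmul, hsum, norm_div, Complex.norm_natCast, div_le_iff₀ hKr]
  refine (norm_sum_le_of_le _ hterm).trans ?_
  rw [sum_const, hcard, nsmul_eq_mul, mul_comm]

theorem tendsto_floor_exp_atTop (c : ℝ) :
    Tendsto (fun j : ℕ => ⌊Real.exp (j + c)⌋₊) atTop atTop :=
  tendsto_nat_floor_atTop.comp (Real.tendsto_exp_atTop.comp
    (tendsto_atTop_add_const_right _ c tendsto_natCast_atTop_atTop))

theorem tendsto_floor_exp_cpow (c : ℝ) :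
    Tendsto (fun j : ℕ => ((⌊Real.exp (j + c)⌋₊ : ℕ) : ℂ) ^ (2 * (Real.pi : ℂ) * Complex.I))
      atTop (nhds (Complex.exp (2 * (Real.pi : ℂ) * Complex.I * c))) := by
  set s : ℂ := 2 * (Real.pi : ℂ) * Complex.I with hs
  have hratio : Tendsto (fun j : ℕ => (⌊Real.exp (j + c)⌋₊ : ℝ) / Real.exp (j + c)) atTop
      (nhds 1) :=
    (tendsto_nat_floor_div_atTop (R := ℝ)).comp (Real.tendsto_exp_atTop.comp
      (tendsto_atTop_add_const_right _ c tendsto_natCast_atTop_atTop))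
  have hpow := ((Complex.continuous_ofReal.tendsto 1).comp hratio).cpow
    (tendsto_const_nhds (x := s)) (by simp [Complex.slitPlane])
  have hlim := hpow.const_mul (Complex.exp (s * c))
  rw [Complex.ofReal_one, Complex.one_cpow, mul_one] at hlim
  refine hlim.congr fun j => ?_
  have hexp : ((Real.exp (j + c) : ℝ) : ℂ) ^ s = Complex.exp (s * c) := by
    rw [Complex.cpow_def_of_ne_zero (by exact_mod_cast (Real.exp_pos _).ne'),
      ← Complex.ofReal_log (Real.exp_pos _).le, Real.log_exp]
    have : ((j + c : ℝ) : ℂ) * s = s * c + j * (2 * Real.pi * Complex.I) := by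
      rw [hs]; push_cast; ring
    rw [this, Complex.exp_add, Complex.exp_nat_mul_two_pi_mul_I, mul_one]
  simp only [Function.comp]
  rw [← hexp, ← Complex.mul_cpow_ofReal_nonneg (by positivity) (by positivity),
    ← Complex.ofReal_mul, mul_div_cancel₀ _ (Real.exp_pos _).ne', Complex.ofReal_natCast]

theorem average_n_two_pi_i_diverges :
    ¬ ∃ L : ℂ, Tendsto (fun N : ℕ =>
        (∑ n ∈ Finset.Icc 1 N, (n : ℂ) ^ (2 * (Real.pi : ℂ) * Complex.I)) / N)
      atTop (nhds L) := by
  rintro ⟨L, hL⟩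
  have hclose (c : ℝ) : ‖L - (20 : ℂ) ^ (2 * (Real.pi : ℂ) * Complex.I) *
      Complex.exp (2 * (Real.pi : ℂ) * Complex.I * c)‖ ≤ 1 / 3 := by
    refine le_of_tendsto (((tendsto_window_average hL).comp (tendsto_floor_exp_atTop c)).sub
      ((tendsto_floor_exp_cpow c).const_mul _)).norm ?_
    filter_upwards [(tendsto_floor_exp_atTop c).eventually_gt_atTop 0] with j hj
    exact norm_window_average_sub_le hj
  have h0 := hclose 0
  have h1 := hclose (1 / 2)
  have hhalf : 2 * (Real.pi : ℂ) * Complex.I * ((1 / 2 : ℝ) : ℂ) = Real.pi * Complex.I := by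
    push_cast; ring
  rw [hhalf, Complex.exp_pi_mul_I] at h1
  rw [Complex.ofReal_zero, mul_zero, Complex.exp_zero] at h0
  set w : ℂ := (20 : ℂ) ^ (2 * (Real.pi : ℂ) * Complex.I) with hw
  have hwn : ‖w‖ = 1 := by
    have := Complex.norm_cpow_eq_rpow_re_of_pos (x := 20) (by norm_num)
      (2 * (Real.pi : ℂ) * Complex.I)
    simpa [hw] using this
  have h2 : ‖(2 : ℂ) * w‖ ≤ 1 / 3 + 1 / 3 := by
    have : (2 : ℂ) * w = (L - w * -1) - (L - w * 1) := by ring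
    rw [this]
    exact (norm_sub_le _ _).trans (add_le_add h1 h0)
  rw [norm_mul, hwn] at h2
  norm_num at h2
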